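/- Let S_1, S_2, S_3 be finite-dimensional quantum strategies (with the same question sets and answer sets) and let ε_1, ε_2 ≥ 0. If S_1 is a local ε_1-dilation of S_2 and S_2 is a local ε_2-dilation of S_3, then S_1 is a local (ε_1 + ε_2)-dilation of S_3. -/

import Mathlib

open scoped Matrix Kronecker ComplexOrder

noncomputable section
namespace QST

/-- Euclidean norm of a finite complex vector. -/
def evnorm {ι : Type} [Fintype ι] (v : ι → ℂ) : ℝ :=
  Real.sqrt (∑ i, ‖v i‖ ^ 2)

/-- Inner product `⟨v, w⟩`, linear in the first argument. -/
def pinner {ι : Type} [Fintype ι] (v w : ι → ℂ) : ℂ :=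
  ∑ i, v i * (starRingEnd ℂ) (w i)

/-- Reduced density matrix of `ψψ*` on the first tensor factor. -/
def rhoA {dA dB : ℕ} (ψ : Fin dA × Fin dB → ℂ) : Matrix (Fin dA) (Fin dA) ℂ :=
  Matrix.of fun a a' => ∑ b, ψ (a, b) * (starRingEnd ℂ) (ψ (a', b))

/-- Reduced density matrix of `ψψ*` on the second tensor factor. -/
def rhoB {dA dB : ℕ} (ψ : Fin dA × Fin dB → ℂ) : Matrix (Fin dB) (Fin dB) ℂ :=
  Matrix.of fun b b' => ∑ a, ψ (a, b) * (starRingEnd ℂ) (ψ (a, b'))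

/-- The state-dependent seminorm `‖X‖_ρ = (tr (X* X ρ))^(1/2)`. -/
def rnorm {d : ℕ} (ρ X : Matrix (Fin d) (Fin d) ℂ) : ℝ :=
  Real.sqrt ((Xᴴ * X * ρ).trace).re

/-- Operator (spectral) norm of a matrix. -/
def opNorm {d : ℕ} (X : Matrix (Fin d) (Fin d) ℂ) : ℝ :=
  ‖Matrix.toEuclideanCLM (𝕜 := ℂ) X‖

/-- `P = P* = P²`. -/
def IsProjection {d : ℕ} (P : Matrix (Fin d) (Fin d) ℂ) : Prop :=
  Pᴴ = P ∧ P * P = P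

/-- 1-norm distance between correlations. -/
def dist1 {n k : ℕ} (p q : Fin n → Fin n → Fin k → Fin k → ℝ) : ℝ :=
  ∑ v, ∑ w, ∑ i, ∑ j, |p v w i j - q v w i j|

/-- Membership in the set `C_q(n,k)` of quantum correlations. -/
def IsQuantumCorrelation (n k : ℕ) (p : Fin n → Fin n → Fin k → Fin k → ℝ) : Prop :=
  ∃ (dA dB : ℕ) (ψ : Fin dA × Fin dB → ℂ)
    (E : Fin n → Fin k → Matrix (Fin dA) (Fin dA) ℂ)
    (F : Fin n → Fin k → Matrix (Fin dB) (Fin dB) ℂ),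
    evnorm ψ = 1 ∧ (∀ v i, (E v i).PosSemidef) ∧ (∀ v, ∑ i, E v i = 1) ∧
    (∀ w j, (F w j).PosSemidef) ∧ (∀ w, ∑ j, F w j = 1) ∧
    ∀ v w i j, (p v w i j : ℂ) = pinner ((E v i ⊗ₖ F w j).mulVec ψ) ψ

/-- Strategy 1 (the "tilde" strategy) is a local `ε`-dilation of strategy 2. -/
def IsLocalDilation {n k : ℕ} (ε : ℝ) {d1A d1B d2A d2B : ℕ}
    (ψ1 : Fin d1A × Fin d1B → ℂ)
    (E1 : Fin n → Fin k → Matrix (Fin d1A) (Fin d1A) ℂ)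
    (F1 : Fin n → Fin k → Matrix (Fin d1B) (Fin d1B) ℂ)
    (ψ2 : Fin d2A × Fin d2B → ℂ)
    (E2 : Fin n → Fin k → Matrix (Fin d2A) (Fin d2A) ℂ)
    (F2 : Fin n → Fin k → Matrix (Fin d2B) (Fin d2B) ℂ) : Prop :=
  ∃ (kA kB : ℕ) (VA : Matrix (Fin d1A × Fin kA) (Fin d2A) ℂ)
    (VB : Matrix (Fin d1B × Fin kB) (Fin d2B) ℂ) (χ : Fin kA × Fin kB → ℂ),
    VAᴴ * VA = 1 ∧ VBᴴ * VB = 1 ∧ evnorm χ = 1 ∧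
    evnorm (fun y : (Fin d1A × Fin d1B) × (Fin kA × Fin kB) =>
        ((VA ⊗ₖ VB).mulVec ψ2) ((y.1.1, y.2.1), (y.1.2, y.2.2)) - ψ1 y.1 * χ y.2) ≤ ε ∧
    ∀ (v w : Fin n) (i j : Fin k),
      evnorm (fun y : (Fin d1A × Fin d1B) × (Fin kA × Fin kB) =>
        ((VA ⊗ₖ VB).mulVec ((E2 v i ⊗ₖ F2 w j).mulVec ψ2)) ((y.1.1, y.2.1), (y.1.2, y.2.2))
          - ((E1 v i ⊗ₖ F1 w j).mulVec ψ1) y.1 * χ y.2) ≤ ε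

/-- The sequence generating `Λ_n` for `n ≥ 4`. -/
def lambdaSeq (n : ℕ) : ℕ → ℝ
  | 0 => 0
  | l + 1 => 1 + 1 / ((n : ℝ) - 1 - lambdaSeq n l)

/-- The sets `Λ_n`. -/
def Lambda (n : ℕ) : Set ℝ :=
  if n = 3 then {3 / 2} else Set.range (lambdaSeq n)

/-- The maximally entangled state `φ_d`. -/
def phid (d : ℕ) : Fin d × Fin d → ℂ :=
  fun y => if y.1 = y.2 then (((Real.sqrt d)⁻¹ : ℝ) : ℂ) else 0

/-- The two-outcome measurement `{M, 1 - M}`. -/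
def canonPair {d : ℕ} (M : Matrix (Fin d) (Fin d) ℂ) : Fin 2 → Matrix (Fin d) (Fin d) ℂ :=
  fun i => if i = 0 then M else 1 - M

theorem evnorm_eq_norm {ι : Type} [Fintype ι] (v : ι → ℂ) :
    evnorm v = ‖(WithLp.toLp 2 v : EuclideanSpace ℂ ι)‖ := by
  rw [EuclideanSpace.norm_eq]; rfl

theorem evnorm_add_le {ι : Type} [Fintype ι] (v w : ι → ℂ) :
    evnorm (fun i => v i + w i) ≤ evnorm v + evnorm w := by
  rw [evnorm_eq_norm, evnorm_eq_norm, evnorm_eq_norm]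
  exact norm_add_le (WithLp.toLp 2 v : EuclideanSpace ℂ ι) (WithLp.toLp 2 w)

theorem evnorm_equiv {ι κ : Type} [Fintype ι] [Fintype κ] (e : ι ≃ κ) (v : κ → ℂ) :
    evnorm (fun i => v (e i)) = evnorm v := by
  unfold evnorm
  rw [Equiv.sum_comp e (fun i => ‖v i‖ ^ 2)]

theorem sumsq_eq {ι : Type} [Fintype ι] (v : ι → ℂ) :
    ((∑ i, ‖v i‖ ^ 2 : ℝ) : ℂ) = star v ⬝ᵥ v := by
  simp [dotProduct, Complex.conj_mul']

theorem sumsq_isometry {ι κ : Type} [Fintype ι] [Fintype κ] [DecidableEq κ]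
    (M : Matrix ι κ ℂ) (hM : Mᴴ * M = 1) (v : κ → ℂ) :
    ∑ i, ‖(M.mulVec v) i‖ ^ 2 = ∑ i, ‖v i‖ ^ 2 := by
  have : ((∑ i, ‖(M.mulVec v) i‖ ^ 2 : ℝ) : ℂ) = ((∑ i, ‖v i‖ ^ 2 : ℝ) : ℂ) := by
    rw [sumsq_eq, sumsq_eq, Matrix.star_mulVec, Matrix.dotProduct_mulVec,
      Matrix.vecMul_vecMul, hM, Matrix.vecMul_one]
  exact_mod_cast this

theorem evnorm_isometry {ι κ l : Type} [Fintype ι] [Fintype κ] [Fintype l] [DecidableEq κ]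
    (M : Matrix ι κ ℂ) (hM : Mᴴ * M = 1) (r : κ × l → ℂ) :
    evnorm (fun z : ι × l => M.mulVec (fun p => r (p, z.2)) z.1) = evnorm r := by
  unfold evnorm
  rw [Fintype.sum_prod_type_right, Fintype.sum_prod_type_right]
  congr 1
  exact Finset.sum_congr rfl fun y _ => sumsq_isometry M hM (fun p => r (p, y))

theorem evnorm_tensor {ι κ : Type} [Fintype ι] [Fintype κ] (s : ι → ℂ) (t : κ → ℂ) :
    evnorm (fun z : ι × κ => s z.1 * t z.2) = evnorm s * evnorm t := by
  unfold evnorm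
  rw [← Real.sqrt_mul (Finset.sum_nonneg fun i _ => by positivity), Fintype.sum_prod_type,
    Finset.sum_mul_sum]
  simp [mul_pow]

/-- index splitting -/
def ie (a k l : ℕ) : Fin a × Fin (k * l) ≃ (Fin a × Fin k) × Fin l :=
  (Equiv.prodCongr (Equiv.refl _) finProdFinEquiv.symm).trans (Equiv.prodAssoc _ _ _).symm

/-- composite isometry -/
def comp {a k l b c : ℕ} (V : Matrix (Fin a × Fin k) (Fin b) ℂ)
    (W : Matrix (Fin b × Fin l) (Fin c) ℂ) : Matrix (Fin a × Fin (k * l)) (Fin c) ℂ :=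
  ((V ⊗ₖ (1 : Matrix (Fin l) (Fin l) ℂ)) * W).submatrix (ie a k l) id

theorem comp_iso {a k l b c : ℕ} (V : Matrix (Fin a × Fin k) (Fin b) ℂ)
    (W : Matrix (Fin b × Fin l) (Fin c) ℂ) (hV : Vᴴ * V = 1) (hW : Wᴴ * W = 1) :
    (comp V W)ᴴ * comp V W = 1 := by
  unfold comp
  rw [Matrix.conjTranspose_submatrix, Matrix.submatrix_mul_equiv, Matrix.conjTranspose_mul,
    Matrix.mul_assoc, ← Matrix.mul_assoc _ _ W, Matrix.conjTranspose_kronecker,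
    ← Matrix.mul_kronecker_mul, hV]
  simp [hW]

theorem comp_mulVec {a k l b c a' k' l' b' c' : ℕ} (V : Matrix (Fin a × Fin k) (Fin b) ℂ)
    (W : Matrix (Fin b × Fin l) (Fin c) ℂ) (V' : Matrix (Fin a' × Fin k') (Fin b') ℂ)
    (W' : Matrix (Fin b' × Fin l') (Fin c') ℂ) (x : Fin c × Fin c' → ℂ)
    (p : Fin a × Fin (k * l)) (q : Fin a' × Fin (k' * l')) :
    (comp V W ⊗ₖ comp V' W').mulVec x (p, q) =
      (V ⊗ₖ V').mulVec (fun y => (W ⊗ₖ W').mulVec x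
        ((y.1, (ie a k l p).2), (y.2, (ie a' k' l' q).2)))
        ((ie a k l p).1, (ie a' k' l' q).1) := by
  have h : (comp V W ⊗ₖ comp V' W').mulVec x (p, q) =
      ((V ⊗ₖ (1 : Matrix (Fin l) (Fin l) ℂ)) ⊗ₖ (V' ⊗ₖ (1 : Matrix (Fin l') (Fin l') ℂ))).mulVec
        ((W ⊗ₖ W').mulVec x) (ie a k l p, ie a' k' l' q) := by
    rw [Matrix.mulVec_mulVec, ← Matrix.mul_kronecker_mul]
    rfl
  rw [h]
  generalize (W ⊗ₖ W').mulVec x = u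
  generalize ie a k l p = p
  generalize ie a' k' l' q = q
  simp [Matrix.mulVec, dotProduct, Fintype.sum_prod_type, Matrix.one_apply]

theorem key {d1A d1B d2A d2B d3A d3B kA kB lA lB : ℕ} {ε1 ε2 : ℝ}
    (VA : Matrix (Fin d1A × Fin kA) (Fin d2A) ℂ) (VB : Matrix (Fin d1B × Fin kB) (Fin d2B) ℂ)
    (χ : Fin kA × Fin kB → ℂ)
    (WA : Matrix (Fin d2A × Fin lA) (Fin d3A) ℂ) (WB : Matrix (Fin d2B × Fin lB) (Fin d3B) ℂ)
    (ξ : Fin lA × Fin lB → ℂ) (hVA : VAᴴ * VA = 1) (hVB : VBᴴ * VB = 1) (hξ : evnorm ξ = 1)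
    (x1 : Fin d1A × Fin d1B → ℂ) (x2 : Fin d2A × Fin d2B → ℂ) (x3 : Fin d3A × Fin d3B → ℂ)
    (h1 : evnorm (fun y : (Fin d1A × Fin d1B) × (Fin kA × Fin kB) =>
        ((VA ⊗ₖ VB).mulVec x2) ((y.1.1, y.2.1), (y.1.2, y.2.2)) - x1 y.1 * χ y.2) ≤ ε1)
    (h2 : evnorm (fun y : (Fin d2A × Fin d2B) × (Fin lA × Fin lB) =>
        ((WA ⊗ₖ WB).mulVec x3) ((y.1.1, y.2.1), (y.1.2, y.2.2)) - x2 y.1 * ξ y.2) ≤ ε2) :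
    evnorm (fun y : (Fin d1A × Fin d1B) × (Fin (kA * lA) × Fin (kB * lB)) =>
        ((comp VA WA ⊗ₖ comp VB WB).mulVec x3) ((y.1.1, y.2.1), (y.1.2, y.2.2))
        - x1 y.1 * (χ ((finProdFinEquiv.symm y.2.1).1, (finProdFinEquiv.symm y.2.2).1) *
          ξ ((finProdFinEquiv.symm y.2.1).2, (finProdFinEquiv.symm y.2.2).2))) ≤ ε1 + ε2 := by
  have hV : (VA ⊗ₖ VB)ᴴ * (VA ⊗ₖ VB) = 1 := by
    rw [Matrix.conjTranspose_kronecker, ← Matrix.mul_kronecker_mul, hVA, hVB,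
      Matrix.one_kronecker_one]
  set r := (fun y : (Fin d2A × Fin d2B) × (Fin lA × Fin lB) =>
        ((WA ⊗ₖ WB).mulVec x3) ((y.1.1, y.2.1), (y.1.2, y.2.2)) - x2 y.1 * ξ y.2) with hr
  set s := (fun y : (Fin d1A × Fin d1B) × (Fin kA × Fin kB) =>
        ((VA ⊗ₖ VB).mulVec x2) ((y.1.1, y.2.1), (y.1.2, y.2.2)) - x1 y.1 * χ y.2) with hs
  let e1 : (Fin d1A × Fin d1B) × (Fin (kA * lA) × Fin (kB * lB)) ≃
      ((Fin d1A × Fin kA) × (Fin d1B × Fin kB)) × (Fin lA × Fin lB) :=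
    (Equiv.prodProdProdComm _ _ _ _).trans
      (((ie d1A kA lA).prodCongr (ie d1B kB lB)).trans (Equiv.prodProdProdComm _ _ _ _))
  let R := fun z : ((Fin d1A × Fin kA) × (Fin d1B × Fin kB)) × (Fin lA × Fin lB) =>
    (VA ⊗ₖ VB).mulVec (fun p => r (p, z.2)) z.1
  let s' := fun z : (Fin d1A × Fin kA) × (Fin d1B × Fin kB) =>
    s (Equiv.prodProdProdComm _ _ _ _ z)
  let T := fun z : ((Fin d1A × Fin kA) × (Fin d1B × Fin kB)) × (Fin lA × Fin lB) =>
    s' z.1 * ξ z.2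
  have hR : evnorm R = evnorm r := evnorm_isometry _ hV r
  have hT : evnorm T = evnorm s := by
    rw [evnorm_tensor, hξ, mul_one]
    exact evnorm_equiv _ s
  have hfun : (fun y : (Fin d1A × Fin d1B) × (Fin (kA * lA) × Fin (kB * lB)) =>
        ((comp VA WA ⊗ₖ comp VB WB).mulVec x3) ((y.1.1, y.2.1), (y.1.2, y.2.2))
        - x1 y.1 * (χ ((finProdFinEquiv.symm y.2.1).1, (finProdFinEquiv.symm y.2.2).1) *
          ξ ((finProdFinEquiv.symm y.2.1).2, (finProdFinEquiv.symm y.2.2).2))) =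
      fun y => (fun z => T z + R z) (e1 y) := by
    funext y
    rw [comp_mulVec]
    obtain ⟨⟨a, b⟩, ⟨m, n⟩⟩ := y
    have hRR : R (e1 ((a, b), (m, n))) = (VA ⊗ₖ VB).mulVec (fun y => (WA ⊗ₖ WB).mulVec x3
        ((y.1, (ie d1A kA lA (a, m)).2), (y.2, (ie d1B kB lB (b, n)).2)))
        ((ie d1A kA lA (a, m)).1, (ie d1B kB lB (b, n)).1) -
        (VA ⊗ₖ VB).mulVec x2 ((ie d1A kA lA (a, m)).1, (ie d1B kB lB (b, n)).1) *
          ξ ((ie d1A kA lA (a, m)).2, (ie d1B kB lB (b, n)).2) := by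
      simp only [Matrix.mulVec, dotProduct, Finset.sum_mul, ← Finset.sum_sub_distrib]
      refine Finset.sum_congr rfl fun p _ => ?_
      rw [mul_assoc, ← mul_sub]
      rfl
    have hTT : T (e1 ((a, b), (m, n))) =
        ((VA ⊗ₖ VB).mulVec x2 ((ie d1A kA lA (a, m)).1, (ie d1B kB lB (b, n)).1)
          - x1 (a, b) * χ ((finProdFinEquiv.symm m).1, (finProdFinEquiv.symm n).1)) *
          ξ ((ie d1A kA lA (a, m)).2, (ie d1B kB lB (b, n)).2) := rfl
    have hx : ξ ((finProdFinEquiv.symm m).2, (finProdFinEquiv.symm n).2) =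
      ξ ((ie d1A kA lA (a, m)).2, (ie d1B kB lB (b, n)).2) := rfl
    show _ = T (e1 ((a, b), (m, n))) + R (e1 ((a, b), (m, n)))
    rw [hRR, hTT]
    dsimp only
    rw [hx]
    ring
  rw [hfun, evnorm_equiv e1 (fun z => T z + R z)]
  refine (evnorm_add_le T R).trans ?_
  rw [hR, hT]
  exact add_le_add h1 h2

theorem statement3 {n k : ℕ} (ε1 ε2 : ℝ) (hε1 : 0 ≤ ε1) (hε2 : 0 ≤ ε2)
    {d1A d1B d2A d2B d3A d3B : ℕ}
    (ψ1 : Fin d1A × Fin d1B → ℂ)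
    (E1 : Fin n → Fin k → Matrix (Fin d1A) (Fin d1A) ℂ)
    (F1 : Fin n → Fin k → Matrix (Fin d1B) (Fin d1B) ℂ)
    (ψ2 : Fin d2A × Fin d2B → ℂ)
    (E2 : Fin n → Fin k → Matrix (Fin d2A) (Fin d2A) ℂ)
    (F2 : Fin n → Fin k → Matrix (Fin d2B) (Fin d2B) ℂ)
    (ψ3 : Fin d3A × Fin d3B → ℂ)
    (E3 : Fin n → Fin k → Matrix (Fin d3A) (Fin d3A) ℂ)
    (F3 : Fin n → Fin k → Matrix (Fin d3B) (Fin d3B) ℂ)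
    (hψ1 : evnorm ψ1 = 1)
    (hE1pos : ∀ v i, (E1 v i).PosSemidef) (hE1sum : ∀ v, ∑ i, E1 v i = 1)
    (hF1pos : ∀ w j, (F1 w j).PosSemidef) (hF1sum : ∀ w, ∑ j, F1 w j = 1)
    (hψ2 : evnorm ψ2 = 1)
    (hE2pos : ∀ v i, (E2 v i).PosSemidef) (hE2sum : ∀ v, ∑ i, E2 v i = 1)
    (hF2pos : ∀ w j, (F2 w j).PosSemidef) (hF2sum : ∀ w, ∑ j, F2 w j = 1)
    (hψ3 : evnorm ψ3 = 1)
    (hE3pos : ∀ v i, (E3 v i).PosSemidef) (hE3sum : ∀ v, ∑ i, E3 v i = 1)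
    (hF3pos : ∀ w j, (F3 w j).PosSemidef) (hF3sum : ∀ w, ∑ j, F3 w j = 1)
    (h12 : IsLocalDilation ε1 ψ1 E1 F1 ψ2 E2 F2)
    (h23 : IsLocalDilation ε2 ψ2 E2 F2 ψ3 E3 F3) :
    IsLocalDilation (ε1 + ε2) ψ1 E1 F1 ψ3 E3 F3 := by
  obtain ⟨kA, kB, VA, VB, χ, hVA, hVB, hχ, h1, h1'⟩ := h12
  obtain ⟨lA, lB, WA, WB, ξ, hWA, hWB, hξ, h2, h2'⟩ := h23
  refine ⟨kA * lA, kB * lB, comp VA WA, comp VB WB,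
    fun y => χ ((finProdFinEquiv.symm y.1).1, (finProdFinEquiv.symm y.2).1) *
          ξ ((finProdFinEquiv.symm y.1).2, (finProdFinEquiv.symm y.2).2),
    comp_iso _ _ hVA hWA, comp_iso _ _ hVB hWB, ?_, ?_, ?_⟩
  · have h := evnorm_equiv ((finProdFinEquiv.symm.prodCongr finProdFinEquiv.symm).trans
      (Equiv.prodProdProdComm (Fin kA) (Fin lA) (Fin kB) (Fin lB)))
      (fun z => χ z.1 * ξ z.2)
    rw [evnorm_tensor, hχ, hξ, mul_one] at h
    exact h
  · exact key VA VB χ WA WB ξ hVA hVB hξ ψ1 ψ2 ψ3 h1 h2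
  · intro v w i j
    exact key VA VB χ WA WB ξ hVA hVB hξ _ _ _ (h1' v w i j) (h2' v w i j)

end QST
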